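/- arXiv:2211.10632 — 2 statements merged into one kernel-verified Lean document; each statement's English description precedes it below -/
import Mathlib

section
/- Solvability of the discrete Dirichlet problem: for every finite set Ω ⊆ ℤ×ℤ and every data function D : ℤ×ℤ → ℝ there exists exactly one function p : ℤ×ℤ → ℝ with p(i,j) = 0 for all (i,j) ∉ Ω and (L p)(i,j) = D(i,j) for all (i,j) ∈ Ω. -/
/-- The sum of the four coefficients. -/
noncomputable def Kcoef (k1 k2 k3 k4 : ℤ × ℤ → ℝ) (x : ℤ × ℤ) : ℝ :=
  k1 x + k2 x + k3 x + k4 x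

/-- The discrete elliptic (Reynolds) operator on the integer grid. -/
noncomputable def Lop (k1 k2 k3 k4 : ℤ × ℤ → ℝ) (p : ℤ × ℤ → ℝ) (x : ℤ × ℤ) : ℝ :=
  k1 x * p (x.1 + 1, x.2) + k2 x * p (x.1 - 1, x.2) +
  k3 x * p (x.1, x.2 + 1) + k4 x * p (x.1, x.2 - 1) -
  Kcoef k1 k2 k3 k4 x * p x


/-- The operator `Lop` as a linear map. -/
noncomputable def LopLinear (k1 k2 k3 k4 : ℤ × ℤ → ℝ) :
    (ℤ × ℤ → ℝ) →ₗ[ℝ] (ℤ × ℤ → ℝ) where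
  toFun := Lop k1 k2 k3 k4
  map_add' p q := by
    funext x
    simp only [Lop, Pi.add_apply]
    ring
  map_smul' c p := by
    funext x
    simp only [Lop, Pi.smul_apply, smul_eq_mul, RingHom.id_apply]
    ring

/-- Discrete maximum principle: a function that vanishes off a finite set `Ω` and satisfies
`0 ≤ L p` on `Ω` is nonpositive. -/
theorem nonpos_of_Lop_nonneg {k1 k2 k3 k4 : ℤ × ℤ → ℝ}
    (hk1 : ∀ x, 0 < k1 x) (hk2 : ∀ x, 0 < k2 x)
    (hk3 : ∀ x, 0 < k3 x) (hk4 : ∀ x, 0 < k4 x)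
    {Ω : Set (ℤ × ℤ)} (hΩ : Ω.Finite) {p : ℤ × ℤ → ℝ}
    (hp : ∀ x ∉ Ω, p x = 0) (hL : ∀ x ∈ Ω, 0 ≤ Lop k1 k2 k3 k4 p x) (x : ℤ × ℤ) :
    p x ≤ 0 := by
  by_contra! hx
  have mem_of_pos : ∀ y, 0 < p y → y ∈ Ω := fun y hy ↦ by
    by_contra hyΩ
    exact hy.ne' (hp y hyΩ)
  obtain ⟨m, -, hmax⟩ := Set.exists_max_image Ω p hΩ ⟨x, mem_of_pos x hx⟩
  have hm : 0 < p m := hx.trans_le (hmax x (mem_of_pos x hx))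
  have hle : ∀ y, p y ≤ p m := fun y ↦ by
    by_cases hy : y ∈ Ω
    · exact hmax y hy
    · exact (hp y hy).trans_le hm.le
  -- The rightmost maximiser has a right neighbour that is a maximiser as well.
  obtain ⟨z, ⟨hzΩ, hz⟩, hright⟩ := Set.exists_max_image {y ∈ Ω | p y = p m} Prod.fst
    (hΩ.subset (Set.sep_subset _ _)) ⟨m, mem_of_pos m hm, rfl⟩
  have hLz := hL z hzΩ
  simp only [Lop, Kcoef, hz] at hLz
  have h2 := mul_le_mul_of_nonneg_left (hle (z.1 - 1, z.2)) (hk2 z).le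
  have h3 := mul_le_mul_of_nonneg_left (hle (z.1, z.2 + 1)) (hk3 z).le
  have h4 := mul_le_mul_of_nonneg_left (hle (z.1, z.2 - 1)) (hk4 z).le
  have hge : p m ≤ p (z.1 + 1, z.2) :=
    le_of_mul_le_mul_left (by linarith) (hk1 z)
  have := hright (z.1 + 1, z.2) ⟨mem_of_pos _ (hm.trans_le hge), (hle _).antisymm hge⟩
  simp at this

/-- The homogeneous discrete Dirichlet problem has only the zero solution. -/
theorem eq_zero_of_Lop_eq_zero {k1 k2 k3 k4 : ℤ × ℤ → ℝ}
    (hk1 : ∀ x, 0 < k1 x) (hk2 : ∀ x, 0 < k2 x)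
    (hk3 : ∀ x, 0 < k3 x) (hk4 : ∀ x, 0 < k4 x)
    {Ω : Set (ℤ × ℤ)} (hΩ : Ω.Finite) {p : ℤ × ℤ → ℝ}
    (hp : ∀ x ∉ Ω, p x = 0) (hL : ∀ x ∈ Ω, Lop k1 k2 k3 k4 p x = 0) : p = 0 := by
  funext x
  refine (nonpos_of_Lop_nonneg hk1 hk2 hk3 hk4 hΩ hp (fun y hy ↦ (hL y hy).ge) x).antisymm ?_
  have hneg := nonpos_of_Lop_nonneg hk1 hk2 hk3 hk4 hΩ (p := -p)
    (fun y hy ↦ by simp [hp y hy])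
    (fun y hy ↦ by
      have h : Lop k1 k2 k3 k4 (-p) y = -Lop k1 k2 k3 k4 p y :=
        congrFun ((LopLinear k1 k2 k3 k4).map_neg p) y
      rw [h, hL y hy, neg_zero]) x
  simpa using hneg

/-- Existence and uniqueness for the discrete Dirichlet problem. -/
theorem discrete_dirichlet_solvability
    (k1 k2 k3 k4 : ℤ × ℤ → ℝ)
    (hk1 : ∀ x, 0 < k1 x) (hk2 : ∀ x, 0 < k2 x)
    (hk3 : ∀ x, 0 < k3 x) (hk4 : ∀ x, 0 < k4 x)
    (Ω : Set (ℤ × ℤ)) (hΩ : Ω.Finite)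
    (D : ℤ × ℤ → ℝ) :
    ∃! p : ℤ × ℤ → ℝ,
      (∀ x ∉ Ω, p x = 0) ∧ (∀ x ∈ Ω, Lop k1 k2 k3 k4 p x = D x) := by
  have := hΩ.to_subtype
  let E : (Ω → ℝ) →ₗ[ℝ] (ℤ × ℤ → ℝ) := Function.ExtendByZero.linearMap ℝ Subtype.val
  have hE_mem : ∀ q (x : Ω), E q x = q x := fun q x ↦
    Subtype.val_injective.extend_apply q 0 x
  have hE_notMem : ∀ q, ∀ x ∉ Ω, E q x = 0 := fun q x hx ↦
    Function.extend_apply' (f := Subtype.val) q (0 : ℤ × ℤ → ℝ) x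
      fun ⟨y, hy⟩ ↦ hx (hy ▸ y.2)
  let T : (Ω → ℝ) →ₗ[ℝ] (Ω → ℝ) :=
    LinearMap.funLeft ℝ ℝ Subtype.val ∘ₗ LopLinear k1 k2 k3 k4 ∘ₗ E
  have hT : Function.Injective T := by
    refine (injective_iff_map_eq_zero T).2 fun q hq ↦ funext fun x ↦ ?_
    have h := eq_zero_of_Lop_eq_zero hk1 hk2 hk3 hk4 hΩ (hE_notMem q)
      fun y hy ↦ congrFun hq ⟨y, hy⟩
    rw [← hE_mem q x, h]
    rfl
  obtain ⟨q, hq⟩ := LinearMap.injective_iff_surjective.1 hT fun x ↦ D x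
  have hLq : ∀ x ∈ Ω, Lop k1 k2 k3 k4 (E q) x = D x := fun x hx ↦ congrFun hq ⟨x, hx⟩
  refine ⟨E q, ⟨hE_notMem q, hLq⟩, fun r ⟨hr, hLr⟩ ↦ sub_eq_zero.1 ?_⟩
  refine eq_zero_of_Lop_eq_zero hk1 hk2 hk3 hk4 hΩ
    (fun x hx ↦ by simp [hr x hx, hE_notMem q x hx]) fun x hx ↦ ?_
  have h : Lop k1 k2 k3 k4 (r - E q) x = Lop k1 k2 k3 k4 r x - Lop k1 k2 k3 k4 (E q) x :=
    congrFun ((LopLinear k1 k2 k3 k4).map_sub r (E q)) x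
  rw [h, hLr x hx, hLq x hx, sub_self]
end

section
/- Existence for the discrete complementarity (natural boundary) problem: the solution p⁰ on Ω⁰ solves the discrete complementarity problem on Ω_D; in particular (L p⁰)(i,j) ≤ D(i,j) for every (i,j) ∈ Ω_D \ Ω⁰. -/
/-- `p` is a solution on `Ω` for data `D`: it vanishes outside `Ω` and satisfies the
discrete equation `L p = D` on `Ω`. -/
def IsSolutionOn (k1 k2 k3 k4 D : ℤ × ℤ → ℝ) (Ω : Set (ℤ × ℤ)) (p : ℤ × ℤ → ℝ) : Prop :=
  (∀ x ∉ Ω, p x = 0) ∧ (∀ x ∈ Ω, Lop k1 k2 k3 k4 p x = D x)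

/-- `p` solves the discrete complementarity (natural boundary) problem on `ΩD`. -/
def SolvesCP (k1 k2 k3 k4 D : ℤ × ℤ → ℝ) (ΩD : Set (ℤ × ℤ)) (p : ℤ × ℤ → ℝ) : Prop :=
  (∀ x ∉ ΩD, p x = 0) ∧ (∀ x, 0 ≤ p x) ∧
  (∀ x ∈ ΩD, Lop k1 k2 k3 k4 p x ≤ D x) ∧
  (∀ x, 0 < p x → Lop k1 k2 k3 k4 p x = D x)

/-- Comparison at a touching point: raising the neighbouring values raises `L`. -/
lemma Lop_le_Lop_of_le_of_eq {k1 k2 k3 k4 : ℤ × ℤ → ℝ}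
    (hk1 : ∀ x, 0 < k1 x) (hk2 : ∀ x, 0 < k2 x)
    (hk3 : ∀ x, 0 < k3 x) (hk4 : ∀ x, 0 < k4 x)
    {f g : ℤ × ℤ → ℝ} (hfg : ∀ y, f y ≤ g y) {x : ℤ × ℤ} (hx : f x = g x) :
    Lop k1 k2 k3 k4 f x ≤ Lop k1 k2 k3 k4 g x := by
  unfold Lop
  rw [hx]
  have h1 := mul_le_mul_of_nonneg_left (hfg (x.1 + 1, x.2)) (hk1 x).le
  have h2 := mul_le_mul_of_nonneg_left (hfg (x.1 - 1, x.2)) (hk2 x).le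
  have h3 := mul_le_mul_of_nonneg_left (hfg (x.1, x.2 + 1)) (hk3 x).le
  have h4 := mul_le_mul_of_nonneg_left (hfg (x.1, x.2 - 1)) (hk4 x).le
  linarith

lemma Lop_sub (k1 k2 k3 k4 f g : ℤ × ℤ → ℝ) (x : ℤ × ℤ) :
    Lop k1 k2 k3 k4 (f - g) x = Lop k1 k2 k3 k4 f x - Lop k1 k2 k3 k4 g x := by
  simp only [Lop, Pi.sub_apply]
  ring

/-- Discrete minimum principle on a finite domain. -/
lemma nonneg_of_Lop_nonpos {k1 k2 k3 k4 : ℤ × ℤ → ℝ}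
    (hk1 : ∀ x, 0 < k1 x) (hk2 : ∀ x, 0 < k2 x)
    (hk3 : ∀ x, 0 < k3 x) (hk4 : ∀ x, 0 < k4 x)
    {Ω : Set (ℤ × ℤ)} (hΩ : Ω.Finite) {u : ℤ × ℤ → ℝ}
    (hout : ∀ x ∉ Ω, 0 ≤ u x) (hin : ∀ x ∈ Ω, Lop k1 k2 k3 k4 u x ≤ 0) (x : ℤ × ℤ) :
    0 ≤ u x := by
  by_contra! hneg
  have mem_of_neg : ∀ y, u y < 0 → y ∈ Ω := fun y hy => by
    by_contra h
    exact absurd (hout y h) (not_le.2 hy)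
  obtain ⟨a, ha, hamin⟩ := Set.exists_min_image Ω u hΩ ⟨x, mem_of_neg x hneg⟩
  have ha_neg : u a < 0 := (hamin x (mem_of_neg x hneg)).trans_lt hneg
  have hmin : ∀ y, u a ≤ u y := fun y => by
    by_cases hy : y ∈ Ω
    · exact hamin y hy
    · exact ha_neg.le.trans (hout y hy)
  obtain ⟨b, ⟨hb, hba⟩, hbmax⟩ := Set.exists_max_image {y ∈ Ω | u y = u a} Prod.fst
    (hΩ.subset (Set.sep_subset _ _)) ⟨a, ha, rfl⟩
  have hright : u a < u (b.1 + 1, b.2) := by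
    refine lt_of_le_of_ne (hmin _) fun h => ?_
    have := hbmax (b.1 + 1, b.2) ⟨mem_of_neg _ (h ▸ ha_neg), h.symm⟩
    simp at this
  have hL := hin b hb
  unfold Lop Kcoef at hL
  rw [hba] at hL
  have h1 := mul_lt_mul_of_pos_left hright (hk1 b)
  have h2 := mul_le_mul_of_nonneg_left (hmin (b.1 - 1, b.2)) (hk2 b).le
  have h3 := mul_le_mul_of_nonneg_left (hmin (b.1, b.2 + 1)) (hk3 b).le
  have h4 := mul_le_mul_of_nonneg_left (hmin (b.1, b.2 - 1)) (hk4 b).le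
  linarith

/-- Discrete comparison principle on a finite domain. -/
lemma le_of_Lop_le {k1 k2 k3 k4 : ℤ × ℤ → ℝ}
    (hk1 : ∀ x, 0 < k1 x) (hk2 : ∀ x, 0 < k2 x)
    (hk3 : ∀ x, 0 < k3 x) (hk4 : ∀ x, 0 < k4 x)
    {Ω : Set (ℤ × ℤ)} (hΩ : Ω.Finite) {f g : ℤ × ℤ → ℝ}
    (hout : ∀ x ∉ Ω, f x ≤ g x)
    (hin : ∀ x ∈ Ω, Lop k1 k2 k3 k4 g x ≤ Lop k1 k2 k3 k4 f x) (x : ℤ × ℤ) :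
    f x ≤ g x := by
  refine sub_nonneg.1 (nonneg_of_Lop_nonpos hk1 hk2 hk3 hk4 hΩ (u := g - f)
    (fun y hy => sub_nonneg.2 (hout y hy)) (fun y hy => ?_) x)
  rw [Lop_sub]
  exact sub_nonpos.2 (hin y hy)

lemma exists_isSolutionOn {k1 k2 k3 k4 : ℤ × ℤ → ℝ}
    (hk1 : ∀ x, 0 < k1 x) (hk2 : ∀ x, 0 < k2 x)
    (hk3 : ∀ x, 0 < k3 x) (hk4 : ∀ x, 0 < k4 x) (D : ℤ × ℤ → ℝ)
    {Ω : Set (ℤ × ℤ)} (hΩ : Ω.Finite) :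
    ∃ p, IsSolutionOn k1 k2 k3 k4 D Ω p := by
  have := hΩ.to_subtype
  let E : (Ω → ℝ) →ₗ[ℝ] (ℤ × ℤ → ℝ) := Function.ExtendByZero.linearMap ℝ Subtype.val
  have hE_out : ∀ f, ∀ x ∉ Ω, E f x = 0 := fun f x hx =>
    Function.extend_apply' _ _ _ (by rintro ⟨y, rfl⟩; exact hx y.2)
  have hE_in : ∀ f (x : Ω), E f x = f x := fun f x =>
    Subtype.val_injective.extend_apply _ _ x
  let T : (Ω → ℝ) →ₗ[ℝ] (Ω → ℝ) :=
    { toFun := fun f x => Lop k1 k2 k3 k4 (E f) x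
      map_add' := fun f g => by
        ext x
        simp only [Lop, map_add, Pi.add_apply]
        ring
      map_smul' := fun c f => by
        ext x
        simp only [Lop, map_smul, Pi.smul_apply, smul_eq_mul, RingHom.id_apply]
        ring }
  have hle : ∀ f g, T f = T g → ∀ x, E f x ≤ E g x := fun f g h =>
    le_of_Lop_le hk1 hk2 hk3 hk4 hΩ (fun x hx => by rw [hE_out f x hx, hE_out g x hx])
      (fun x hx => (congrFun h ⟨x, hx⟩).ge)
  have hinj : Function.Injective T := fun f g h => by
    ext x
    rw [← hE_in f x, ← hE_in g x]
    exact le_antisymm (hle f g h x) (hle g f h.symm x)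
  obtain ⟨f, hf⟩ := LinearMap.injective_iff_surjective.1 hinj fun x => D x
  exact ⟨E f, hE_out f, fun x hx => congrFun hf ⟨x, hx⟩⟩

/-- The solution on a finite union of domains with nonnegative solutions is nonnegative. -/
lemma IsSolutionOn.nonneg_of_iUnion {k1 k2 k3 k4 D : ℤ × ℤ → ℝ}
    (hk1 : ∀ x, 0 < k1 x) (hk2 : ∀ x, 0 < k2 x)
    (hk3 : ∀ x, 0 < k3 x) (hk4 : ∀ x, 0 < k4 x)
    {ι : Type*} [Finite ι] {Ω : ι → Set (ℤ × ℤ)} (hΩ : (⋃ i, Ω i).Finite)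
    {P : ι → ℤ × ℤ → ℝ} (hP : ∀ i, IsSolutionOn k1 k2 k3 k4 D (Ω i) (P i))
    (hP_nonneg : ∀ i x, 0 ≤ P i x) {p : ℤ × ℤ → ℝ}
    (hp : IsSolutionOn k1 k2 k3 k4 D (⋃ i, Ω i) p) (x : ℤ × ℤ) : 0 ≤ p x := by
  let q : ℤ × ℤ → ℝ := fun y => ⨆ i, P i y
  have hPq : ∀ i y, P i y ≤ q y := fun i y => le_ciSup (Set.finite_range fun i => P i y).bddAbove i
  have hq_nonneg : ∀ y, 0 ≤ q y := fun y => Real.iSup_nonneg fun i => hP_nonneg i y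
  refine (hq_nonneg x).trans (le_of_Lop_le hk1 hk2 hk3 hk4 hΩ (fun y hy => ?_) (fun y hy => ?_) x)
  · rw [hp.1 y hy]
    refine Real.iSup_nonpos fun i => ((hP i).1 y fun h => hy ?_).le
    exact Set.mem_iUnion_of_mem i h
  · rw [hp.2 y hy]
    obtain ⟨j, hj⟩ := Set.mem_iUnion.1 hy
    have : Nonempty ι := ⟨j⟩
    obtain ⟨i, hi⟩ := exists_eq_ciSup_of_finite (f := fun i => P i y)
    obtain ⟨l, hl, hlq⟩ : ∃ l, y ∈ Ω l ∧ P l y = q y := by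
      by_cases hyi : y ∈ Ω i
      · exact ⟨i, hyi, hi⟩
      · refine ⟨j, hj, le_antisymm (hPq j y) ?_⟩
        have hq : q y = 0 := hi.symm.trans ((hP i).1 y hyi)
        exact hq.trans_le (hP_nonneg j y)
    rw [← (hP l).2 y hl]
    exact Lop_le_Lop_of_le_of_eq hk1 hk2 hk3 hk4 (hPq l) hlq

/-- Existence for the discrete complementarity (natural boundary) problem: the solution
`p⁰` on the greatest nonnegative-solution domain `Ω⁰` solves the discrete complementarity
problem on `Ω_D`; in particular `(L p⁰)(i,j) ≤ D(i,j)` on `Ω_D \ Ω⁰`. -/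
theorem solution_on_greatest_domain_solves_CP
    (k1 k2 k3 k4 : ℤ × ℤ → ℝ)
    (hk1 : ∀ x, 0 < k1 x) (hk2 : ∀ x, 0 < k2 x)
    (hk3 : ∀ x, 0 < k3 x) (hk4 : ∀ x, 0 < k4 x)
    (D : ℤ × ℤ → ℝ)
    (ΩD : Set (ℤ × ℤ)) (hΩD : ΩD.Finite)
    (Ω0 : Set (ℤ × ℤ))
    (hΩ0 : Ω0 = ⋃₀ {Ω : Set (ℤ × ℤ) | Ω ⊆ ΩD ∧
      ∃ p : ℤ × ℤ → ℝ, IsSolutionOn k1 k2 k3 k4 D Ω p ∧ ∀ x, 0 ≤ p x})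
    (p0 : ℤ × ℤ → ℝ)
    (hp0 : IsSolutionOn k1 k2 k3 k4 D Ω0 p0) :
    SolvesCP k1 k2 k3 k4 D ΩD p0 ∧
      ∀ x ∈ ΩD \ Ω0, Lop k1 k2 k3 k4 p0 x ≤ D x := by
  have hsub : Ω0 ⊆ ΩD := by
    rw [hΩ0]
    exact Set.sUnion_subset fun Ω h => h.1
  have hfin : Ω0.Finite := hΩD.subset hsub
  have hnonneg : ∀ x, 0 ≤ p0 x := by
    let S : Set (Set (ℤ × ℤ)) := {Ω | Ω ⊆ ΩD ∧
      ∃ p : ℤ × ℤ → ℝ, IsSolutionOn k1 k2 k3 k4 D Ω p ∧ ∀ x, 0 ≤ p x}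
    have : Finite S := (hΩD.finite_subsets.subset fun Ω h => h.1).to_subtype
    choose P hP hP_nonneg using fun s : S => s.2.2
    have hU : Ω0 = ⋃ s : S, (s : Set (ℤ × ℤ)) := hΩ0.trans Set.sUnion_eq_iUnion
    exact IsSolutionOn.nonneg_of_iUnion hk1 hk2 hk3 hk4 (hU ▸ hfin) hP hP_nonneg (hU ▸ hp0)
  have hout : ∀ x ∈ ΩD \ Ω0, Lop k1 k2 k3 k4 p0 x ≤ D x := by
    rintro x ⟨hxD, hx0⟩
    by_contra! hlt
    have hfin' : (insert x Ω0).Finite := hfin.insert x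
    obtain ⟨p, hp⟩ := exists_isSolutionOn hk1 hk2 hk3 hk4 D hfin'
    have hle : ∀ y, p0 y ≤ p y := by
      refine le_of_Lop_le hk1 hk2 hk3 hk4 hfin' (fun y hy => ?_) (fun y hy => ?_)
      · rw [hp.1 y hy, hp0.1 y fun h => hy (Set.mem_insert_of_mem x h)]
      · rw [hp.2 y hy]
        rcases hy with rfl | hy
        · exact hlt.le
        · exact (hp0.2 y hy).ge
    apply hx0
    rw [hΩ0]
    exact ⟨insert x Ω0, ⟨Set.insert_subset hxD hsub, p, hp, fun y => (hnonneg y).trans (hle y)⟩,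
      Set.mem_insert x Ω0⟩
  refine ⟨⟨fun x hx => hp0.1 x fun h => hx (hsub h), hnonneg, fun x hx => ?_, fun x hx => ?_⟩, hout⟩
  · by_cases hx0 : x ∈ Ω0
    · exact (hp0.2 x hx0).le
    · exact hout x ⟨hx, hx0⟩
  · refine hp0.2 x ?_
    by_contra h
    exact hx.ne' (hp0.1 x h)
end
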